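/- For every integer k ≥ 1, Algorithm A_k solves 1/(2k+1)-approximate agreement wait-free for two processes using 1-bit registers: (i) in every execution, every process that keeps taking steps decides after performing at most 2k+3 atomic read/write steps; (ii) if x_1 = x_2, then every process that decides outputs x_1; (iii) every output lies in the set {m/(2k+1) : 0 ≤ m ≤ 2k+1}; and (iv) if both processes decide, their outputs differ by at most 1/(2k+1). -/

import Mathlib

/-!
Operational semantics of the two-process 1-bit-register approximate-agreement
protocol `A_k` (Algorithm 1 of the paper).

The two processes are indexed by `Fin 2`.  Shared memory consists of two 1-bit
registers `R 0, R 1` (initialized to `false`, i.e. `0`; only process `i` writes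
`R i`) and two write-once input registers `I 0, I 1` (initialized to `⊥ = none`).
Each read or write of a single register is one atomic step.  An execution is
determined by the inputs `x : Fin 2 → Bool` together with a schedule
`sched : ℕ → Fin 2` telling which process takes the next step (a step of a
process that has already decided is a no-op; a process crashes by being
scheduled only finitely often).
-/

namespace AlgoAk

/-- The other process. -/
def other (i : Fin 2) : Fin 2 := if i = 0 then 1 else 0

/-- The value (0 or 1) as a rational. -/
def bq (b : Bool) : ℚ := if b then 1 else 0

/-- Program counter of a process:
`start` = about to write its input to its input register;
`loopW` = about to perform the write of the current for-loop iteration;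
`loopR` = about to perform the read of the current for-loop iteration;
`readMine` = left the for-loop, about to read its own input register;
`readOther` = about to read the other input register (and then decide);
`done` = has decided. -/
inductive PC where
  | start | loopW | loopR | readMine | readOther | done
deriving DecidableEq

/-- Local state of a process: program counter, loop variable `r`, local
variables `prec` and `new`, the value read from the other input register,
and the output (once decided). -/
structure PState where
  pc : PC
  r : ℕ
  prec : Bool
  new : Bool
  xother : Option Bool
  out : Option ℚ

/-- Global configuration: local states, the two 1-bit registers, and the two
write-once input registers. -/
structure Config where
  p : Fin 2 → PState
  R : Fin 2 → Bool
  I : Fin 2 → Option Bool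

/-- Initial local state. -/
def initP : PState := ⟨PC.start, 1, false, false, none, none⟩

/-- Initial configuration. -/
def initC : Config := ⟨fun _ => initP, fun _ => false, fun _ => none⟩

/-- Update the local state of process `i`. -/
def updP (c : Config) (i : Fin 2) (s : PState) : Config :=
  { c with p := Function.update c.p i s }

/-- The decision function of the protocol, computed from the process' own input
`xme`, the value `xother` read from the other input register, and the values
`r` and `new` of the local variables when the for-loop was left. -/
def decideVal (k : ℕ) (xme : Bool) (xother : Option Bool) (r : ℕ) (new : Bool) : ℚ :=
  match xother with
  | none => bq xme
  | some xo =>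
    if xme = xo then bq xme
    else if r = k ∧ new = decide (k % 2 = 1) then
      -- normal termination after k iterations
      let xwho := if r % 2 = 0 then xme else xo
      (bq xwho + (k : ℚ)) / (2 * (k : ℚ) + 1)
    else
      -- left the loop via a break at iteration r
      let xwho := if r % 2 = 0 then xo else xme
      bq xwho + ((-1 : ℚ) ^ (if xwho then 1 else 0) * ((r : ℚ) - 1)) / (2 * (k : ℚ) + 1)

/-- One atomic step of process `i` in configuration `c`. -/
def step (k : ℕ) (x : Fin 2 → Bool) (c : Config) (i : Fin 2) : Config :=
  let s := c.p i
  match s.pc with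
  | PC.start =>
      let c' := updP c i { s with pc := PC.loopW }
      { c' with I := Function.update c'.I i (some (x i)) }
  | PC.loopW =>
      let c' := updP c i { s with pc := PC.loopR }
      { c' with R := Function.update c'.R i (decide (s.r % 2 = 1)) }
  | PC.loopR =>
      let nv := c.R (other i)
      if nv ≠ s.prec then
        if s.r < k then
          updP c i { s with pc := PC.loopW, r := s.r + 1, prec := nv, new := nv }
        else
          updP c i { s with pc := PC.readMine, prec := nv, new := nv }
      else
        updP c i { s with pc := PC.readMine, new := nv }
  | PC.readMine =>
      updP c i { s with pc := PC.readOther }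
  | PC.readOther =>
      let xo := c.I (other i)
      updP c i { s with pc := PC.done, xother := xo,
                        out := some (decideVal k (x i) xo s.r s.new) }
  | PC.done => c

/-- The configuration after `n` steps of the execution of `A_k` with inputs `x`
and schedule `sched`. -/
def run (k : ℕ) (x : Fin 2 → Bool) (sched : ℕ → Fin 2) : ℕ → Config
  | 0 => initC
  | n + 1 => step k x (run k x sched n) (sched n)

end AlgoAk

namespace AlgoAk

lemma other_other (i : Fin 2) : other (other i) = i := by
  fin_cases i <;> rfl

lemma other_ne (i : Fin 2) : other i ≠ i := by
  fin_cases i <;> decide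

lemma eq_or_eq_other (i j : Fin 2) : j = i ∨ j = other i := by
  fin_cases i <;> fin_cases j <;> decide

/-- The process has left its for-loop. -/
def PState.Exited (s : PState) : Prop :=
  s.pc = PC.readMine ∨ s.pc = PC.readOther ∨ s.pc = PC.done

/-- The process has left its for-loop through a break. -/
def PState.Broke (s : PState) : Prop :=
  s.Exited ∧ s.new ≠ decide (s.r % 2 = 1)

/-- The number of writes the process has performed on its 1-bit register. -/
def PState.writes (s : PState) : ℕ :=
  if s.pc = PC.start ∨ s.pc = PC.loopW then s.r - 1 else s.r

open Classical in
/-- The number of loop iterations in which the process has seen a new value. -/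
noncomputable def PState.successes (s : PState) : ℕ :=
  if s.Exited ∧ s.new = decide (s.r % 2 = 1) then s.r else s.r - 1

/-- Invariant of one process: `xi`, `xj` are the inputs of the process and of the other one, `s` is
its local state, and `b`, `v` are the contents of its 1-bit register and of its input register. -/
structure LocalInv (k : ℕ) (xi xj : Bool) (s : PState) (b : Bool) (v : Option Bool) : Prop where
  one_le : 1 ≤ s.r
  le : s.r ≤ k
  reg : b = decide (s.writes % 2 = 1)
  input : v = if s.pc = PC.start then none else some xi
  start : s.pc = PC.start → s.r = 1
  prec : ¬ s.Exited → s.prec = decide ((s.r - 1) % 2 = 1)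
  normal : s.Exited → s.new = decide (s.r % 2 = 1) → s.r = k
  out_eq : s.out = if s.pc = PC.done then some (decideVal k xi s.xother s.r s.new) else none
  xother_eq : s.pc = PC.done → s.xother = some xj ∨ s.xother = none ∧ s.r = 1 ∧ s.Broke

/-- Invariant relating the local states of the two processes. -/
structure JointInv (s t : PState) : Prop where
  left : s.successes ≤ t.writes
  right : t.successes ≤ s.writes
  not_both : s.Broke → t.Broke → s.r ≠ t.r

lemma JointInv.symm {s t : PState} (h : JointInv s t) : JointInv t s :=
  ⟨h.right, h.left, fun ht hs => (h.not_both hs ht).symm⟩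

/-- The global invariant of the protocol. -/
structure Inv (k : ℕ) (x : Fin 2 → Bool) (c : Config) : Prop where
  loc : ∀ i, LocalInv k (x i) (x (other i)) (c.p i) (c.R i) (c.I i)
  joint : ∀ i, JointInv (c.p i) (c.p (other i))

lemma inv_initC {k : ℕ} (hk : 1 ≤ k) (x : Fin 2 → Bool) : Inv k x initC := by
  constructor
  · intro i
    constructor <;> simp [initC, initP, PState.writes, PState.Exited, hk]
  · intro i
    constructor <;>
      simp [initC, initP, PState.writes, PState.successes, PState.Exited, PState.Broke]

lemma step_p_other (k : ℕ) (x : Fin 2 → Bool) (c : Config) (i : Fin 2) :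
    (step k x c i).p (other i) = c.p (other i) ∧ (step k x c i).R (other i) = c.R (other i) ∧
      (step k x c i).I (other i) = c.I (other i) := by
  have := other_ne i
  rcases hs : c.p i with ⟨pc, r, prec, new, xo, out⟩
  cases pc <;> simp only [step, hs] <;> (try split_ifs) <;>
    simp [updP, Function.update_of_ne this]

set_option maxHeartbeats 1000000 in
lemma Inv.step_self {k : ℕ} {x : Fin 2 → Bool} {c : Config} (h : Inv k x c) (i : Fin 2) :
    LocalInv k (x i) (x (other i)) ((step k x c i).p i) ((step k x c i).R i)
      ((step k x c i).I i) ∧ JointInv ((step k x c i).p i) (c.p (other i)) := by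
  obtain ⟨h1, h2, h3, h4, h5, h6, h7, h8, h9⟩ := h.loc i
  obtain ⟨g1, g2, g3, g4, g5, g6, g7, g8, g9⟩ := h.loc (other i)
  obtain ⟨j1, j2, j3⟩ := h.joint i
  rcases hs : c.p i with ⟨pc, r, prec, new, xo, out⟩
  rcases ht : c.p (other i) with ⟨pc', r', prec', new', xo', out'⟩
  simp only [hs, ht, PState.writes, PState.successes, PState.Exited, PState.Broke]
    at h1 h2 h3 h4 h5 h6 h7 h8 h9 g1 g2 g3 g4 g5 g6 g7 g8 g9 j1 j2 j3 ⊢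
  cases pc
  all_goals simp only [step, hs]
  all_goals (try split_ifs)
  all_goals try simp only [updP, Function.update_self]
  all_goals refine ⟨⟨?_, ?_, ?_, ?_, ?_, ?_, ?_, ?_, ?_⟩, ⟨?_, ?_, ?_⟩⟩
  all_goals clear hs ht
  all_goals simp only [PState.writes, PState.successes, PState.Exited, PState.Broke, reduceCtorEq,
    or_self, or_true, or_false, not_true, not_false_iff, true_and, false_and, if_true, if_false,
    forall_const, false_imp_iff] at *
  all_goals grind

lemma Inv.step {k : ℕ} {x : Fin 2 → Bool} {c : Config} (h : Inv k x c) (i : Fin 2) :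
    Inv k x (step k x c i) := by
  obtain ⟨hl, hj⟩ := h.step_self i
  obtain ⟨hp, hR, hI⟩ := step_p_other k x c i
  constructor
  · intro j
    rcases eq_or_eq_other i j with rfl | rfl
    · exact hl
    · rw [hp, hR, hI]
      exact h.loc _
  · intro j
    rcases eq_or_eq_other i j with rfl | rfl
    · rwa [hp]
    · rw [hp, other_other]
      exact hj.symm

lemma inv_run {k : ℕ} (hk : 1 ≤ k) (x : Fin 2 → Bool) (sched : ℕ → Fin 2) (n : ℕ) :
    Inv k x (run k x sched n) := by
  induction n with
  | zero => exact inv_initC hk x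
  | succ n ih => exact ih.step _

/-- The number of steps after which, at the latest, a process reaches its current position. -/
def PState.position (k : ℕ) (s : PState) : ℕ :=
  match s.pc with
  | PC.start => 0
  | PC.loopW => 2 * s.r - 1
  | PC.loopR => 2 * s.r
  | PC.readMine => 2 * k + 1
  | PC.readOther => 2 * k + 2
  | PC.done => 2 * k + 3

lemma Inv.position_lt_step {k : ℕ} {x : Fin 2 → Bool} {c : Config} (h : Inv k x c) (i : Fin 2)
    (hd : (c.p i).pc ≠ PC.done) :
    (c.p i).position k < ((AlgoAk.step k x c i).p i).position k := by
  have h1 := (h.loc i).one_le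
  have h2 := (h.loc i).le
  have h3 := (h.loc i).start
  rcases hs : c.p i with ⟨pc, r, prec, new, xo, out⟩
  simp only [hs] at h1 h2 h3 hd
  cases pc <;> simp only [AlgoAk.step, hs] <;> (try split_ifs) <;>
    simp [updP, PState.position] at h1 h2 h3 hd ⊢ <;> omega

lemma step_of_done {k : ℕ} {x : Fin 2 → Bool} {c : Config} {i : Fin 2}
    (h : (c.p i).pc = PC.done) : step k x c i = c := by
  simp [step, h]

lemma step_p_of_done {k : ℕ} {x : Fin 2 → Bool} {c : Config} {i : Fin 2}
    (h : (c.p i).pc = PC.done) (j : Fin 2) : (step k x c j).p i = c.p i := by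
  rcases eq_or_eq_other j i with rfl | rfl
  · rw [step_of_done h]
  · exact (step_p_other k x c j).1

lemma run_p_of_done {k : ℕ} {x : Fin 2 → Bool} {sched : ℕ → Fin 2} {n m : ℕ} (hnm : n ≤ m)
    {i : Fin 2} (h : ((run k x sched n).p i).pc = PC.done) :
    (run k x sched m).p i = (run k x sched n).p i := by
  induction m, hnm using Nat.le_induction with
  | base => rfl
  | succ m _ ih => rw [run, step_p_of_done (by rw [ih, h]), ih]

lemma card_scheduled_le_position {k : ℕ} (hk : 1 ≤ k) (x : Fin 2 → Bool) (sched : ℕ → Fin 2)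
    (n : ℕ) (i : Fin 2) :
    ((run k x sched n).p i).pc = PC.done ∨
      ((Finset.range n).filter (fun m => sched m = i)).card ≤
        ((run k x sched n).p i).position k := by
  induction n with
  | zero => simp
  | succ n ih =>
    by_cases hd : ((run k x sched n).p i).pc = PC.done
    · left
      rwa [run_p_of_done n.le_succ hd]
    have hle := ih.resolve_left hd
    right
    rw [Finset.range_add_one, Finset.filter_insert, run]
    split_ifs with hi
    · rw [hi, Finset.card_insert_of_notMem (by simp)]
      exact hle.trans_lt ((inv_run hk x sched n).position_lt_step i hd)
    · have hi' : i = other (sched n) := (eq_or_eq_other _ _).resolve_left (Ne.symm hi)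
      rw [hi', (step_p_other k x _ _).1, ← hi']
      exact hle

lemma LocalInv.done_of_position {k : ℕ} {xi xj b : Bool} {s : PState} {v : Option Bool}
    (h : LocalInv k xi xj s b v) (hp : 2 * k + 3 ≤ s.position k) : s.pc = PC.done := by
  have := h.le
  unfold PState.position at hp
  split at hp <;> first | assumption | omega

/-- The numerator of the decision value over the denominator `2 * k + 1`. -/
def decideNum (k : ℕ) (xme : Bool) (xother : Option Bool) (r : ℕ) (new : Bool) : ℤ :=
  match xother with
  | none => if xme then 2 * k + 1 else 0
  | some xo =>
    if xme = xo then if xme then 2 * k + 1 else 0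
    else if r = k ∧ new = decide (k % 2 = 1) then
      if (if r % 2 = 0 then xme else xo) then k + 1 else k
    else if (if r % 2 = 0 then xo else xme) then 2 * k + 2 - r else r - 1

lemma decideVal_eq (k : ℕ) (xme : Bool) (xother : Option Bool) (r : ℕ) (new : Bool) :
    decideVal k xme xother r new = (decideNum k xme xother r new : ℚ) / (2 * (k : ℚ) + 1) := by
  have : (2 * (k : ℚ) + 1) ≠ 0 := by positivity
  unfold decideVal decideNum bq
  rcases xother with _ | xo
  · cases xme <;> simp [this]
  · simp only
    split_ifs <;> simp_all <;> field_simp <;> ring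

lemma decideNum_mem (k : ℕ) (xme : Bool) (xother : Option Bool) (r : ℕ) (new : Bool)
    (h1 : 1 ≤ r) (h2 : r ≤ k) :
    0 ≤ decideNum k xme xother r new ∧ decideNum k xme xother r new ≤ 2 * k + 1 := by
  unfold decideNum
  split <;> split_ifs <;> omega

lemma LocalInv.out_eq_some {k : ℕ} {xi xj b : Bool} {s : PState} {v : Option Bool} {y : ℚ}
    (h : LocalInv k xi xj s b v) (hy : s.out = some y) :
    s.pc = PC.done ∧ y = decideVal k xi s.xother s.r s.new := by
  have := h.out_eq
  grind

lemma decideNum_sub_le {k : ℕ} {x y b b' : Bool} {v v' : Option Bool} {s t : PState}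
    (hs : LocalInv k x y s b v) (ht : LocalInv k y x t b' v') (hst : JointInv s t)
    (hsd : s.pc = PC.done) (htd : t.pc = PC.done) :
    decideNum k x s.xother s.r s.new ≤ decideNum k y t.xother t.r t.new + 1 := by
  obtain ⟨h1, h2, -, -, -, -, h7, -, h9⟩ := hs
  obtain ⟨g1, g2, -, -, -, -, g7, -, g9⟩ := ht
  obtain ⟨j1, j2, j3⟩ := hst
  replace h9 := h9 hsd
  replace g9 := g9 htd
  simp only [PState.writes, PState.successes, PState.Exited, PState.Broke, hsd, htd] at *
  rcases h9 with h9 | ⟨h9, h10, h11⟩ <;> rcases g9 with g9 | ⟨g9, g10, g11⟩ <;>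
    simp only [h9, g9, decideNum] <;> cases x <;> cases y <;> grind (splits := 20)

end AlgoAk

open AlgoAk in
/-- Proposition 14: for every `k ≥ 1`, Algorithm `A_k` solves
`1/(2k+1)`-approximate agreement wait-free for two processes using 1-bit
registers:
(i) wait-freedom: any process that has been scheduled at least `2k+3` times has
decided (so a process that keeps taking steps decides after at most `2k+3`
atomic read/write steps);
(ii) validity: if both inputs are equal, every process that decides outputs
that common input;
(iii) every output is of the form `m/(2k+1)` for some `0 ≤ m ≤ 2k+1`;
(iv) agreement: if both processes decide, their outputs are at most `1/(2k+1)`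
apart. -/
theorem algoAk_solves_approximate_agreement (k : ℕ) (hk : 1 ≤ k)
    (x : Fin 2 → Bool) (sched : ℕ → Fin 2) :
    (∀ (n : ℕ) (i : Fin 2),
        2 * k + 3 ≤ ((Finset.range n).filter (fun m => sched m = i)).card →
        ((run k x sched n).p i).pc = PC.done) ∧
    (x 0 = x 1 →
      ∀ (n : ℕ) (i : Fin 2) (y : ℚ),
        ((run k x sched n).p i).out = some y → y = bq (x 0)) ∧
    (∀ (n : ℕ) (i : Fin 2) (y : ℚ),
        ((run k x sched n).p i).out = some y →
        ∃ m : ℕ, m ≤ 2 * k + 1 ∧ y = (m : ℚ) / (2 * (k : ℚ) + 1)) ∧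
    (∀ (n₁ n₂ : ℕ) (y₁ y₂ : ℚ),
        ((run k x sched n₁).p 0).out = some y₁ →
        ((run k x sched n₂).p 1).out = some y₂ →
        |y₁ - y₂| ≤ 1 / (2 * (k : ℚ) + 1)) := by
  have inv := inv_run hk x sched
  have out_of_le {n m : ℕ} (hnm : n ≤ m) {i : Fin 2} {y : ℚ}
      (hy : ((run k x sched n).p i).out = some y) : ((run k x sched m).p i).out = some y := by
    rw [run_p_of_done hnm (((inv n).loc i).out_eq_some hy).1, hy]
  refine ⟨fun n i hcard => ?_, fun hx n i y hy => ?_, fun n i y hy => ?_,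
    fun n₁ n₂ y₁ y₂ hy₁ hy₂ => ?_⟩
  · exact (card_scheduled_le_position hk x sched n i).elim id
      fun hle => ((inv n).loc i).done_of_position (hcard.trans hle)
  · obtain ⟨hd, rfl⟩ := ((inv n).loc i).out_eq_some hy
    have hxi : x i = x 0 ∧ x (other i) = x 0 := by
      fin_cases i <;> simp [other, hx]
    rcases ((inv n).loc i).xother_eq hd with h | ⟨h, -⟩ <;> simp [decideVal, h, hxi]
  · obtain ⟨hd, rfl⟩ := ((inv n).loc i).out_eq_some hy
    obtain ⟨h0, h1⟩ := decideNum_mem k (x i) ((run k x sched n).p i).xother _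
      ((run k x sched n).p i).new ((inv n).loc i).one_le ((inv n).loc i).le
    obtain ⟨m, hm⟩ := Int.eq_ofNat_of_zero_le h0
    refine ⟨m, by omega, ?_⟩
    rw [decideVal_eq, hm, Int.cast_natCast]
  · replace hy₁ := out_of_le (le_max_left n₁ n₂) hy₁
    replace hy₂ := out_of_le (le_max_right n₁ n₂) hy₂
    have I := inv (max n₁ n₂)
    obtain ⟨hd₁, rfl⟩ := (I.loc 0).out_eq_some hy₁
    obtain ⟨hd₂, rfl⟩ := (I.loc 1).out_eq_some hy₂
    have h₁ := decideNum_sub_le (y := x 1) (I.loc 0) (I.loc 1) (I.joint 0) hd₁ hd₂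
    have h₂ := decideNum_sub_le (y := x 0) (I.loc 1) (I.loc 0) (I.joint 1) hd₂ hd₁
    rw [decideVal_eq, decideVal_eq, ← sub_div, abs_div,
      abs_of_pos (show (0 : ℚ) < 2 * (k : ℚ) + 1 by positivity)]
    gcongr
    rw [abs_le]
    constructor
    · have := (Int.cast_le (R := ℚ)).2 h₂
      push_cast at this
      linarith
    · have := (Int.cast_le (R := ℚ)).2 h₁
      push_cast at this
      linarith
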